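/- There exists a constant C (depending only on the alphabet A) such that for any i.i.d. source P generating letters from the finite alphabet A and any integer t ≥ 1, the per-letter estimation error of the Krichevsky estimator K_0 satisfies ρ̄^t(P‖K_0) = t^{−1} Σ_{x_1…x_t ∈ A^t} P(x_1…x_t) log( P(x_1…x_t) / K_0(x_1…x_t) ) ≤ ((|A| − 1)·log t + C)/(2t). -/

import Mathlib

open MeasureTheory Filter Real

/-- The time shift on one-sided infinite sequences. -/
def shiftMap (A : Type) : (ℕ → A) → (ℕ → A) := fun x n => x (n + 1)

/-- The word consisting of the first `t` letters of an infinite sequence. -/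
def prefixWord {A : Type} (t : ℕ) (x : ℕ → A) : Fin t → A := fun i => x i.val

/-- The probability that a source `μ` generates a sequence starting with the word `u`. -/
noncomputable def wordProb {A : Type} [MeasurableSpace A] (μ : Measure (ℕ → A)) {t : ℕ}
    (u : Fin t → A) : ℝ :=
  (μ {x : ℕ → A | ∀ i : Fin t, x i.val = u i}).toReal

/-- The `m`-order conditional Shannon entropy `h_m(P)` (base-2 logarithms). -/
noncomputable def condEnt {A : Type} [MeasurableSpace A] [Fintype A]
    (μ : Measure (ℕ → A)) (m : ℕ) : ℝ :=
  - ∑ v : Fin m → A, wordProb μ v * ∑ a : A,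
      (wordProb μ (Fin.snoc v a) / wordProb μ v) *
        Real.logb 2 (wordProb μ (Fin.snoc v a) / wordProb μ v)

/-- The limiting Shannon entropy `h_∞(P) = lim_m h_m(P)`. -/
noncomputable def entRate {A : Type} [MeasurableSpace A] [Fintype A]
    (μ : Measure (ℕ → A)) : ℝ :=
  limUnder Filter.atTop (fun m => condEnt μ m)

/-- A uniquely decodable code: a family of maps `A^t → {0,1}^*` such that any
concatenation of codewords of words from `A^t` is uniquely decodable. -/
structure UDCode (A : Type) where
  enc : ∀ t : ℕ, (Fin t → A) → List Bool
  ud : ∀ t : ℕ, Function.Injective (fun l : List (Fin t → A) => (l.map (enc t)).flatten)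

/-- The measure associated with a code: `μ_U(u) = 2^{-|U(u)|} / Σ_v 2^{-|U(v)|}`. -/
noncomputable def muU {A : Type} [Fintype A] (U : UDCode A) {t : ℕ} (u : Fin t → A) : ℝ :=
  (2 : ℝ) ^ (-((U.enc t u).length : ℤ)) /
    ∑ v : Fin t → A, (2 : ℝ) ^ (-((U.enc t v).length : ℤ))

/-- A code is universal if, for every stationary ergodic source, the per-letter codeword
length converges to the limiting Shannon entropy a.s. and in expectation. -/
def IsUniversal {A : Type} [Fintype A] [MeasurableSpace A] (U : UDCode A) : Prop :=
  ∀ μ : Measure (ℕ → A), IsProbabilityMeasure μ → Ergodic (shiftMap A) μ →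
    (∀ᵐ x ∂μ, Tendsto (fun t : ℕ => ((U.enc t (prefixWord t x)).length : ℝ) / t) atTop
      (nhds (entRate μ))) ∧
    Tendsto (fun t : ℕ => (∫ x, ((U.enc t (prefixWord t x)).length : ℝ) ∂μ) / t) atTop
      (nhds (entRate μ))

/-- The number of occurrences of `v` as a contiguous subword of `x`. -/
def subwordCount {A : Type} [DecidableEq A] (x v : List A) : ℕ :=
  ((List.range (x.length + 1)).filter (fun i => (x.drop i).take v.length = v)).length

/-- Occurrence count `ν_x(v)` for words given as tuples. -/
def nuCount {A : Type} [DecidableEq A] {t k : ℕ} (x : Fin t → A) (v : Fin k → A) : ℕ :=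
  subwordCount (List.ofFn x) (List.ofFn v)

/-- `ν̄_x(v) = Σ_{a∈A} ν_x(va)`. -/
def nubar {A : Type} [Fintype A] [DecidableEq A] {t m : ℕ} (x : Fin t → A)
    (v : Fin m → A) : ℕ :=
  ∑ a : A, nuCount x (Fin.snoc v a)

/-- The Krichevsky measure `K_m` of order `m`. -/
noncomputable def KMeas {A : Type} [Fintype A] [DecidableEq A] (m : ℕ) {t : ℕ}
    (x : Fin t → A) : ℝ :=
  if t ≤ m then ((Fintype.card A : ℝ))⁻¹ ^ t
  else ((Fintype.card A : ℝ))⁻¹ ^ m *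
    ∏ v : Fin m → A,
      (∏ a : A, Real.Gamma ((nuCount x (Fin.snoc v a) : ℝ) + 1 / 2) / Real.Gamma (1 / 2)) /
        (Real.Gamma ((nubar x v : ℝ) + (Fintype.card A : ℝ) / 2) /
          Real.Gamma ((Fintype.card A : ℝ) / 2))

/-- The probability distribution `ω` on positive integers:
`ω_1 = 1 − 1/log 3`, `ω_i = 1/log(i+1) − 1/log(i+2)` for `i ≥ 2`. -/
noncomputable def omegaW (i : ℕ) : ℝ :=
  if i = 1 then 1 - 1 / Real.logb 2 3
  else 1 / Real.logb 2 (i + 1) - 1 / Real.logb 2 (i + 2)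

/-- The measure `R(u) = Σ_{i=0}^∞ ω_{i+1} K_i(u)`. -/
noncomputable def RMeas {A : Type} [Fintype A] [DecidableEq A] {t : ℕ} (x : Fin t → A) : ℝ :=
  ∑' i : ℕ, omegaW (i + 1) * KMeas i x

/-- The last `k` letters of a word of length `t ≥ k`. -/
def suffixWord {A : Type} {t : ℕ} (k : ℕ) (h : k ≤ t) (u : Fin t → A) : Fin k → A :=
  fun j => u ⟨t - k + j.val, by have := j.isLt; omega⟩

/-- A source is Markov of order (memory) at most `k`: the conditional probability of
the next letter given the whole past equals that given the last `k` letters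
(in cross-multiplied form). -/
def IsMarkov {A : Type} [MeasurableSpace A] (μ : Measure (ℕ → A)) (k : ℕ) : Prop :=
  ∀ t : ℕ, ∀ h : k ≤ t, ∀ u : Fin t → A, ∀ a : A,
    wordProb μ (Fin.snoc u a) * wordProb μ (suffixWord k h u)
      = wordProb μ u * wordProb μ (Fin.snoc (suffixWord k h u) a)

/-- The probability an i.i.d. source with letter distribution `p` assigns to a word. -/
def iidProb {A : Type} (p : A → ℝ) {t : ℕ} (u : Fin t → A) : ℝ := ∏ i : Fin t, p (u i)

/-- The number of occurrences of the letter `a` in the word `x`. -/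
def countLetter {A : Type} [DecidableEq A] {t : ℕ} (x : Fin t → A) (a : A) : ℕ :=
  (Finset.univ.filter (fun i => x i = a)).card

/-- The prefix of `u` of length `i`. -/
def prefixOf {A : Type} {t : ℕ} (u : Fin t → A) (i : Fin t) : Fin i.val → A :=
  fun j => u ⟨j.val, j.isLt.trans i.isLt⟩

/-- The Laplace conditional probability `L_0(a|x) = (ν_x(a)+1)/(t+|A|)`. -/
noncomputable def laplaceCond {A : Type} [Fintype A] [DecidableEq A] {t : ℕ}
    (x : Fin t → A) (a : A) : ℝ :=
  ((countLetter x a : ℝ) + 1) / ((t : ℝ) + (Fintype.card A : ℝ))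

/-- The Laplace measure `L_0(x_1…x_t) = ∏_i L_0(x_i | x_1…x_{i-1})`. -/
noncomputable def laplaceMeas {A : Type} [Fintype A] [DecidableEq A] {t : ℕ}
    (u : Fin t → A) : ℝ :=
  ∏ i : Fin t, laplaceCond (prefixOf u i) (u i)

/-- The Krichevsky measure `K_0` for i.i.d. sources (via the Gamma-function formula). -/
noncomputable def K0Meas {A : Type} [Fintype A] [DecidableEq A] {t : ℕ} (u : Fin t → A) : ℝ :=
  (∏ a : A, Real.Gamma ((countLetter u a : ℝ) + 1 / 2) / Real.Gamma (1 / 2)) /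
    (Real.Gamma ((t : ℝ) + (Fintype.card A : ℝ) / 2) / Real.Gamma ((Fintype.card A : ℝ) / 2))

lemma Real.Gamma_add_half_le_sqrt_mul_Gamma {x : ℝ} (hx : 0 < x) :
    Gamma (x + 1 / 2) ≤ √x * Gamma x := by
  have h := Gamma_mul_add_mul_le_rpow_Gamma_mul_rpow_Gamma hx (by positivity : 0 < x + 1)
    one_half_pos one_half_pos (by norm_num)
  have hG : 0 ≤ Gamma x := (Gamma_pos_of_pos hx).le
  rw [show 1 / 2 * x + 1 / 2 * (x + 1) = x + 1 / 2 by ring, Gamma_add_one hx.ne',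
    ← sqrt_eq_rpow, ← sqrt_eq_rpow, sqrt_mul hx.le] at h
  calc Gamma (x + 1 / 2) ≤ √(Gamma x) * (√x * √(Gamma x)) := h
    _ = √x * (√(Gamma x) * √(Gamma x)) := by ring
    _ = √x * Gamma x := by rw [mul_self_sqrt hG]

lemma Real.pow_div_exp_le_Gamma_add_half (n : ℕ) :
    ((n : ℝ) / exp 1) ^ n ≤ Gamma (n + 1 / 2) := by
  obtain rfl | hn := Nat.eq_zero_or_pos n
  · rw [pow_zero, Nat.cast_zero, zero_add, Gamma_one_half_eq, one_le_sqrt]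
    linarith [pi_gt_three]
  have hn1 : (1 : ℝ) ≤ n := by exact_mod_cast hn
  have h := Gamma_add_half_le_sqrt_mul_Gamma (by positivity : 0 < (n : ℝ) + 1 / 2)
  rw [show (n : ℝ) + 1 / 2 + 1 / 2 = n + 1 by ring, Gamma_nat_eq_factorial] at h
  have hs : √((n : ℝ) + 1 / 2) ≤ √(2 * π * n) := by
    apply sqrt_le_sqrt
    nlinarith [pi_gt_three]
  have hpos : 0 < √((n : ℝ) + 1 / 2) := sqrt_pos.mpr (by positivity)
  refine le_of_mul_le_mul_left ?_ hpos
  calc √((n : ℝ) + 1 / 2) * (n / exp 1) ^ n ≤ √(2 * π * n) * (n / exp 1) ^ n := by gcongr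
    _ ≤ _ := Stirling.le_factorial_stirling n
    _ ≤ _ := h

lemma Stirling.factorial_le_exp_one_mul {n : ℕ} (hn : n ≠ 0) :
    (n.factorial : ℝ) ≤ exp 1 * √n * (n / exp 1) ^ n := by
  obtain ⟨m, rfl⟩ := Nat.exists_eq_succ_of_ne_zero hn
  have h : stirlingSeq (m + 1) ≤ stirlingSeq 1 := stirlingSeq'_antitone (Nat.zero_le m)
  rw [stirlingSeq_one, stirlingSeq, div_le_iff₀ (by positivity)] at h
  rw [sqrt_mul zero_le_two] at h
  refine h.trans_eq ?_
  field_simp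

lemma Real.exists_Gamma_add_half_nat_le (k : ℕ) :
    ∃ D : ℝ, 0 < D ∧ ∀ x : ℝ, 1 ≤ x → Gamma (x + k / 2) ≤ D * √x ^ k * Gamma x := by
  induction k using Nat.twoStepInduction with
  | zero => exact ⟨1, one_pos, fun x _ => by simp⟩
  | one =>
    refine ⟨1, one_pos, fun x hx => ?_⟩
    simpa using Gamma_add_half_le_sqrt_mul_Gamma (one_pos.trans_le hx)
  | more k ih _ =>
    obtain ⟨D, hD, h⟩ := ih
    refine ⟨(1 + k / 2) * D, by positivity, fun x hx => ?_⟩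
    have hx0 : 0 < x := one_pos.trans_le hx
    have hk : x + k / 2 ≤ (1 + k / 2) * x := by
      have : (0 : ℝ) ≤ k / 2 := by positivity
      nlinarith
    have hG : 0 < Gamma (x + k / 2) := Gamma_pos_of_pos (by positivity)
    calc Gamma (x + (k + 2 : ℕ) / 2) = (x + k / 2) * Gamma (x + k / 2) := by
          rw [← Gamma_add_one (by positivity)]
          congr 1
          push_cast
          ring
      _ ≤ ((1 + k / 2) * x) * (D * √x ^ k * Gamma x) := by
          gcongr
          exact h x hx
      _ = (1 + k / 2) * D * √x ^ (k + 2) * Gamma x := by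
          rw [pow_add, sq_sqrt hx0.le]
          ring

lemma sum_countLetter {A : Type} [Fintype A] [DecidableEq A] {t : ℕ} (u : Fin t → A) :
    ∑ a, countLetter u a = t := by
  simpa [countLetter] using
    (Finset.card_eq_sum_card_fiberwise (f := u) (s := Finset.univ) (t := Finset.univ)
      (fun _ _ => Finset.mem_coe.mpr (Finset.mem_univ _))).symm

lemma iidProb_eq_prod_pow {A : Type} [Fintype A] [DecidableEq A] (p : A → ℝ) {t : ℕ}
    (u : Fin t → A) : iidProb p u = ∏ a, p a ^ countLetter u a := by
  simp only [iidProb, countLetter, ← Finset.prod_const]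
  exact (Finset.prod_fiberwise' Finset.univ u p).symm

lemma sum_iidProb {A : Type} [Fintype A] (p : A → ℝ) (t : ℕ) :
    ∑ u : Fin t → A, iidProb p u = (∑ a, p a) ^ t := by
  simp only [iidProb, Fintype.sum_pow]

/-- Gibbs inequality: empirical frequencies maximize the likelihood. -/
lemma prod_pow_mul_pow_sum_le {ι : Type*} [Fintype ι] {p : ι → ℝ} (hp : ∀ i, 0 ≤ p i)
    (hp1 : ∑ i, p i = 1) (n : ι → ℕ) :
    (∏ i, p i ^ n i) * ((∑ i, n i : ℕ) : ℝ) ^ (∑ i, n i) ≤ ∏ i, (n i : ℝ) ^ n i := by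
  set t := ∑ i, n i with ht
  obtain h0 | h0 := Nat.eq_zero_or_pos t
  · have hn : ∀ i, n i = 0 := fun i => by
      simpa using (Finset.sum_eq_zero_iff.mp (ht ▸ h0)) i (Finset.mem_univ i)
    simp [h0, hn]
  have ht0 : (0 : ℝ) < t := by exact_mod_cast h0
  have hz : ∀ i, 0 ≤ p i * t / n i := fun i => by
    have := hp i
    positivity
  have amgm : ∏ i, (p i * t / n i) ^ ((n i : ℝ) / t) ≤ 1 :=
    calc _ ≤ ∑ i, (n i : ℝ) / t * (p i * t / n i) := by
          refine geom_mean_le_arith_mean_weighted _ _ _ (fun i _ => by positivity) ?_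
            (fun i _ => hz i)
          rw [← Finset.sum_div, ← Nat.cast_sum, ← ht, div_self ht0.ne']
      _ ≤ ∑ i, p i := by
          refine Finset.sum_le_sum fun i _ => ?_
          obtain h | h := Nat.eq_zero_or_pos (n i)
          · simpa [h] using hp i
          · have : (0 : ℝ) < n i := by exact_mod_cast h
            apply le_of_eq
            field_simp
      _ = 1 := hp1
  have hprod : ∏ i, (p i * t / n i) ^ n i ≤ 1 := by
    refine le_trans (le_of_eq ?_) (pow_le_one₀ (n := t)
      (Finset.prod_nonneg fun i _ => rpow_nonneg (hz i) _) amgm)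
    rw [← Finset.prod_pow]
    refine Finset.prod_congr rfl fun i _ => ?_
    rw [← rpow_natCast (_ ^ _), ← rpow_mul (hz i), div_mul_cancel₀ _ ht0.ne', rpow_natCast]
  have hn : ∀ i, (0 : ℝ) < (n i : ℝ) ^ n i := fun i => by
    obtain h | h := Nat.eq_zero_or_pos (n i)
    · simp [h]
    · positivity
  calc (∏ i, p i ^ n i) * (t : ℝ) ^ t
      = (∏ i, (p i * t / n i) ^ n i) * ∏ i, (n i : ℝ) ^ n i := by
        conv_lhs => rw [ht, ← Finset.prod_pow_eq_pow_sum, ← ht]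
        rw [← Finset.prod_mul_distrib, ← Finset.prod_mul_distrib]
        refine Finset.prod_congr rfl fun i _ => ?_
        rw [div_pow, div_mul_cancel₀ _ (hn i).ne', mul_pow]
    _ ≤ ∏ i, (n i : ℝ) ^ n i :=
        mul_le_of_le_one_left (Finset.prod_nonneg fun i _ => (hn i).le) hprod

lemma K0Meas_pos {A : Type} [Fintype A] [DecidableEq A] [Nonempty A] {t : ℕ} (u : Fin t → A) :
    0 < K0Meas u := by
  have hk : (0 : ℝ) < Fintype.card A := by exact_mod_cast Fintype.card_pos
  unfold K0Meas
  have h1 : 0 < Gamma ((t : ℝ) + (Fintype.card A : ℝ) / 2) := Gamma_pos_of_pos (by positivity)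
  have h2 : 0 < Gamma ((Fintype.card A : ℝ) / 2) := Gamma_pos_of_pos (by positivity)
  refine div_pos (Finset.prod_pos fun a _ => div_pos ?_ ?_) (div_pos h1 h2) <;>
    exact Gamma_pos_of_pos (by positivity)

/-- The pointwise redundancy bound `P(u) ≤ M t^{(|A|-1)/2} K_0(u)`. -/
lemma exists_iidProb_mul_le_K0Meas (A : Type) [Fintype A] [DecidableEq A] [Nonempty A] :
    ∃ M : ℝ, 0 < M ∧ ∀ p : A → ℝ, (∀ a, 0 ≤ p a) → (∑ a : A, p a) = 1 → ∀ t : ℕ, 1 ≤ t →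
      ∀ u : Fin t → A,
        iidProb p u * t ≤ M * √(t : ℝ) ^ (Fintype.card A + 1) * K0Meas u := by
  set k := Fintype.card A with hkdef
  have hk : (0 : ℝ) < k := by exact_mod_cast Fintype.card_pos
  have hGk : 0 < Gamma ((k : ℝ) / 2) := Gamma_pos_of_pos (by positivity)
  have hGh : 0 < Gamma ((1 : ℝ) / 2) := Gamma_pos_of_pos (by positivity)
  obtain ⟨D, hD, hDle⟩ := exists_Gamma_add_half_nat_le k
  refine ⟨D * exp 1 * Gamma (1 / 2) ^ k / Gamma (k / 2), by positivity,
    fun p hp hp1 t ht u => ?_⟩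
  have ht1 : (1 : ℝ) ≤ t := by exact_mod_cast ht
  have ht0 : (0 : ℝ) < t := one_pos.trans_le ht1
  have hGt : 0 < Gamma ((t : ℝ) + k / 2) := Gamma_pos_of_pos (by positivity)
  have hML : iidProb p u * (t / exp 1) ^ t ≤ ∏ a, Gamma ((countLetter u a : ℝ) + 1 / 2) := by
    have h := prod_pow_mul_pow_sum_le hp hp1 (countLetter u)
    rw [sum_countLetter, ← iidProb_eq_prod_pow] at h
    calc iidProb p u * (t / exp 1) ^ t = iidProb p u * t ^ t / exp 1 ^ t := by
          rw [div_pow, mul_div_assoc]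
      _ ≤ (∏ a, (countLetter u a : ℝ) ^ countLetter u a) / exp 1 ^ t := by gcongr
      _ = ∏ a, ((countLetter u a : ℝ) / exp 1) ^ countLetter u a := by
          simp only [div_pow, Finset.prod_div_distrib, Finset.prod_pow_eq_pow_sum,
            sum_countLetter]
      _ ≤ _ := Finset.prod_le_prod (fun _ _ => by positivity)
          fun _ _ => pow_div_exp_le_Gamma_add_half _
  have hGamma : Gamma ((t : ℝ) + k / 2) * t ≤
      D * exp 1 * √(t : ℝ) ^ (k + 1) * (t / exp 1) ^ t := by
    have hfac : Gamma (t : ℝ) * t = t.factorial := by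
      rw [mul_comm, ← Gamma_add_one ht0.ne', Gamma_nat_eq_factorial]
    calc Gamma ((t : ℝ) + k / 2) * t ≤ D * √(t : ℝ) ^ k * Gamma t * t := by
          gcongr
          exact hDle t ht1
      _ = D * √(t : ℝ) ^ k * t.factorial := by rw [mul_assoc, hfac]
      _ ≤ D * √(t : ℝ) ^ k * (exp 1 * √t * (t / exp 1) ^ t) := by
          gcongr
          exact Stirling.factorial_le_exp_one_mul (by lia)
      _ = _ := by ring
  have hK : K0Meas u = (∏ a, Gamma ((countLetter u a : ℝ) + 1 / 2)) * Gamma (k / 2) /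
      (Gamma (1 / 2) ^ k * Gamma ((t : ℝ) + k / 2)) := by
    rw [K0Meas, Finset.prod_div_distrib, Finset.prod_const, Finset.card_univ, ← hkdef,
      div_div_eq_mul_div, div_mul_eq_mul_div, div_div]
  have hP : 0 ≤ iidProb p u := Finset.prod_nonneg fun i _ => hp (u i)
  rw [hK]
  calc iidProb p u * t = iidProb p u * (Gamma ((t : ℝ) + k / 2) * t) / Gamma (t + k / 2) := by
        field_simp
    _ ≤ iidProb p u * (D * exp 1 * √(t : ℝ) ^ (k + 1) * (t / exp 1) ^ t) /
        Gamma (t + k / 2) := by gcongr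
    _ = D * exp 1 * √(t : ℝ) ^ (k + 1) * (iidProb p u * (t / exp 1) ^ t) /
        Gamma (t + k / 2) := by ring
    _ ≤ D * exp 1 * √(t : ℝ) ^ (k + 1) * (∏ a, Gamma ((countLetter u a : ℝ) + 1 / 2)) /
        Gamma (t + k / 2) := by gcongr
    _ = _ := by
        generalize ∏ a, Gamma ((countLetter u a : ℝ) + 1 / 2) = G
        field_simp

/-- error of the Krichevsky estimator `K_0`, Claim 2 of the paper.
There is a constant `C` (depending only on the alphabet) such that for any i.i.d. source
`P` and any `t ≥ 1`, `ρ̄^t(P‖K_0) ≤ ((|A|−1)·log t + C)/(2t)`. -/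
theorem krichevsky_estimator_error (A : Type) [Fintype A] [DecidableEq A] [Nonempty A] :
    ∃ C : ℝ, ∀ p : A → ℝ, (∀ a, 0 ≤ p a) → (∑ a : A, p a) = 1 → ∀ t : ℕ, 1 ≤ t →
      (t : ℝ)⁻¹ * (∑ u : Fin t → A, iidProb p u * Real.logb 2 (iidProb p u / K0Meas u))
        ≤ (((Fintype.card A : ℝ) - 1) * Real.logb 2 t + C) / (2 * t) := by
  obtain ⟨M, hM, hle⟩ := exists_iidProb_mul_le_K0Meas A
  refine ⟨2 * Real.logb 2 M, fun p hp hp1 t ht => ?_⟩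
  have ht0 : (0 : ℝ) < t := by exact_mod_cast ht
  set B := ((Fintype.card A : ℝ) - 1) / 2 * Real.logb 2 t + Real.logb 2 M with hB
  have hterm : ∀ u : Fin t → A,
      iidProb p u * Real.logb 2 (iidProb p u / K0Meas u) ≤ iidProb p u * B := by
    intro u
    have hP : 0 ≤ iidProb p u := Finset.prod_nonneg fun i _ => hp (u i)
    obtain h0 | hpos := hP.eq_or_lt
    · simp [← h0]
    refine mul_le_mul_of_nonneg_left ?_ hP
    have hK := K0Meas_pos u
    calc Real.logb 2 (iidProb p u / K0Meas u)
        ≤ Real.logb 2 (M * √(t : ℝ) ^ (Fintype.card A + 1) / t) := by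
          refine Real.logb_le_logb_of_le one_lt_two (by positivity) ?_
          rw [div_le_div_iff₀ hK ht0]
          exact hle p hp hp1 t ht u
      _ = B := by
          rw [Real.logb_div (by positivity) ht0.ne', Real.logb_mul hM.ne' (by positivity),
            Real.logb_pow, Real.sqrt_eq_rpow, Real.logb_rpow_eq_mul_logb_of_pos ht0, hB]
          push_cast
          ring
  calc (t : ℝ)⁻¹ * (∑ u : Fin t → A, iidProb p u * Real.logb 2 (iidProb p u / K0Meas u))
      ≤ (t : ℝ)⁻¹ * ∑ u : Fin t → A, iidProb p u * B := by
        exact mul_le_mul_of_nonneg_left (Finset.sum_le_sum fun u _ => hterm u) (by positivity)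
    _ = (t : ℝ)⁻¹ * B := by rw [← Finset.sum_mul, sum_iidProb, hp1, one_pow, one_mul]
    _ = _ := by
        rw [hB]
        field_simp
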